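/- arXiv:math/0601639 — 4 statements merged into one kernel-verified Lean document; each statement's English description precedes it below -/
import Mathlib

section
/- (The isogeny φ_{λ,ν} and its explicit formula.) Let p be an odd prime, S a commutative ring of characteristic p, and λ, ν ∈ S. Define φ_{λ,ν} : W₂^λ(S) → W₂^{λ^p}(S) as the difference F_λ − I_{λ,λ^{p−1}}^ν computed in the commutative group W₂^{λ^p}(S), where F_λ(u₁,u₂) = (u₁^p, u₂^p) and I_{λ,λ^{p−1}}^ν(u₁,u₂) = (ν u₁, λ^{p−1} ν^p u₂). Then φ_{λ,ν} is a group homomorphism and for all (u₁,u₂) ∈ S × S one has φ_{λ,ν}(u₁,u₂) = (u₁^p − ν u₁, u₂^p − ν^p λ^{p−1} u₂ + λ^p · Σ_{k=1}^{p−1} (1/p)·binom(p,k)·u₁^{pk}·(−ν u₁)^{p−k}). -/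
/-- `C_p(u,v) = Σ_{k=1}^{p-1} (1/p)·binom(p,k)·u^k·v^(p-k)`. -/
def wittC (p : ℕ) {S : Type*} [CommRing S] (u v : S) : S :=
  ∑ k ∈ Finset.Ico 1 p, ((p.choose k / p : ℕ) : S) * u ^ k * v ^ (p - k)

/-- The operation of the twisted Witt group `W₂^λ`. -/
def wittMul (p : ℕ) {S : Type*} [CommRing S] (lam : S) (u v : S × S) : S × S :=
  (u.1 + v.1, u.2 + v.2 + lam * wittC p u.1 v.1)

/-- The inverse in the twisted Witt group `W₂^λ`. -/
def wittInv (p : ℕ) {S : Type*} [CommRing S] (lam : S) (u : S × S) : S × S :=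
  (-u.1, -u.2 - lam * wittC p u.1 (-u.1))

/-- The isogeny `φ_{λ,ν} = F_λ − I_{λ,λ^{p−1}}^ν : W₂^λ(S) → W₂^{λ^p}(S)`, the difference being
computed in the commutative group `W₂^{λ^p}(S)`, where `F_λ(u₁,u₂) = (u₁^p, u₂^p)` and
`I_{λ,λ^{p−1}}^ν(u₁,u₂) = (ν u₁, λ^{p−1} ν^p u₂)`. -/
def wittPhi (p : ℕ) {S : Type*} [CommRing S] (lam nu : S) (u : S × S) : S × S :=
  wittMul p (lam ^ p) (u.1 ^ p, u.2 ^ p)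
    (wittInv p (lam ^ p) (nu * u.1, lam ^ (p - 1) * nu ^ p * u.2))

theorem map_wittC (p : ℕ) {R S : Type*} [CommRing R] [CommRing S] (f : R →+* S) (u v : R) :
    f (wittC p u v) = wittC p (f u) (f v) := by
  simp [wittC]

theorem natCast_mul_wittC {p : ℕ} (hp : p.Prime) {R : Type*} [CommRing R] (u v : R) :
    (p : R) * wittC p u v = (u + v) ^ p - u ^ p - v ^ p := by
  have hterm : ∀ k ∈ Finset.Ico 1 p,
      (p : R) * (((p.choose k / p : ℕ) : R) * u ^ k * v ^ (p - k))
        = u ^ k * v ^ (p - k) * (p.choose k : R) := by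
    intro k hk
    rw [Finset.mem_Ico] at hk
    have hdvd : p ∣ p.choose k := hp.dvd_choose_self (by lia) hk.2
    have hcast : (p : R) * ((p.choose k / p : ℕ) : R) = (p.choose k : R) := by
      rw [← Nat.cast_mul, Nat.mul_div_cancel' hdvd]
    rw [← hcast]
    ring
  rw [wittC, Finset.mul_sum, Finset.sum_congr rfl hterm, add_pow, Finset.sum_range_succ,
    Finset.range_eq_Ico, Finset.sum_eq_sum_Ico_succ_bot hp.pos]
  simp

theorem wittC_neg_self {p : ℕ} (hp : p.Prime) (hodd : Odd p) {S : Type*} [CommRing S] (x : S) :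
    wittC p x (-x) = 0 := by
  have huniv : wittC p (Polynomial.X : Polynomial ℤ) (-Polynomial.X) = 0 := by
    have hp0 : (p : Polynomial ℤ) ≠ 0 := by exact_mod_cast hp.ne_zero
    apply mul_left_cancel₀ hp0
    rw [natCast_mul_wittC hp, hodd.neg_pow, add_neg_cancel, zero_pow hp.ne_zero]
    ring
  simpa [map_wittC] using congrArg (Polynomial.eval₂RingHom (Int.castRingHom S) x) huniv

/-- Interchange law for the cocycle `wittC`; over a `p`-torsion-free ring, both sides are
`((a + b + c + d)^p - a^p - b^p - c^p - d^p) / p`. -/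
theorem wittC_add_add_comm {p : ℕ} (hp : p.Prime) {S : Type*} [CommRing S] (a b c d : S) :
    wittC p a b + wittC p c d + wittC p (a + b) (c + d)
      = wittC p a c + wittC p b d + wittC p (a + c) (b + d) := by
  have huniv (a b c d : MvPolynomial (Fin 4) ℤ) :
      wittC p a b + wittC p c d + wittC p (a + b) (c + d)
        = wittC p a c + wittC p b d + wittC p (a + c) (b + d) := by
    have hp0 : (p : MvPolynomial (Fin 4) ℤ) ≠ 0 := by exact_mod_cast hp.ne_zero
    apply mul_left_cancel₀ hp0
    simp only [mul_add, natCast_mul_wittC hp, add_add_add_comm a b c d]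
    ring
  simpa [map_wittC, -MvPolynomial.coe_eval₂Hom] using congrArg (MvPolynomial.eval₂Hom (Int.castRingHom S) ![a, b, c, d])
    (huniv (MvPolynomial.X 0) (MvPolynomial.X 1) (MvPolynomial.X 2) (MvPolynomial.X 3))

theorem wittC_mul_mul (p : ℕ) {S : Type*} [CommRing S] (r u v : S) :
    wittC p (r * u) (r * v) = r ^ p * wittC p u v := by
  rw [wittC, wittC, Finset.mul_sum]
  refine Finset.sum_congr rfl fun k hk => ?_
  rw [← Nat.add_sub_of_le (Finset.mem_Ico.1 hk).2.le, pow_add r, Nat.add_sub_cancel_left]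
  ring

theorem wittC_pow_char {p : ℕ} (hp : p.Prime) {S : Type*} [CommRing S] [CharP S p] (u v : S) :
    wittC p u v ^ p = wittC p (u ^ p) (v ^ p) := by
  have := Fact.mk hp
  exact map_wittC p (frobenius S p) u v

theorem wittPhi_eq {p : ℕ} (hp : p.Prime) (hodd : Odd p) {S : Type*} [CommRing S]
    (lam nu : S) (u : S × S) :
    wittPhi p lam nu u
      = (u.1 ^ p - nu * u.1,
          u.2 ^ p - nu ^ p * lam ^ (p - 1) * u.2 +
            lam ^ p * wittC p (u.1 ^ p) (-(nu * u.1))) := by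
  ext <;> simp only [wittPhi, wittMul, wittInv, wittC_neg_self hp hodd] <;> ring

/-- The isogeny `φ_{λ,ν}` is a group homomorphism and is given by the explicit formula
`φ_{λ,ν}(u₁,u₂) = (u₁^p − ν u₁,
  u₂^p − ν^p λ^{p−1} u₂ + λ^p · Σ_{k=1}^{p−1} (1/p)·binom(p,k)·u₁^{pk}·(−ν u₁)^{p−k})`. -/
theorem wittPhi_isHom_and_formula (p : ℕ) (hp : p.Prime) (hodd : Odd p)
    (S : Type*) [CommRing S] [CharP S p] (lam nu : S) :
    (∀ u v : S × S,
      wittPhi p lam nu (wittMul p lam u v)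
        = wittMul p (lam ^ p) (wittPhi p lam nu u) (wittPhi p lam nu v)) ∧
    (∀ u : S × S,
      wittPhi p lam nu u
        = (u.1 ^ p - nu * u.1,
            u.2 ^ p - nu ^ p * lam ^ (p - 1) * u.2 +
              lam ^ p * ∑ k ∈ Finset.Ico 1 p,
                ((p.choose k / p : ℕ) : S) * u.1 ^ (p * k) * (-(nu * u.1)) ^ (p - k))) := by
  have := Fact.mk hp
  refine ⟨fun u v => ?_, fun u => ?_⟩
  · simp only [wittPhi_eq hp hodd]
    have hlam : lam ^ p = lam ^ (p - 1) * lam := (pow_sub_one_mul hp.ne_zero lam).symm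
    have hscale : wittC p (-(nu * u.1)) (-(nu * v.1)) = -nu ^ p * wittC p u.1 v.1 := by
      rw [← neg_mul, ← neg_mul, wittC_mul_mul, hodd.neg_pow]
    have hcocycle :=
      wittC_add_add_comm hp (u.1 ^ p) (v.1 ^ p) (-(nu * u.1)) (-(nu * v.1))
    rw [hscale, ← neg_add, ← mul_add, ← sub_eq_add_neg, ← sub_eq_add_neg] at hcocycle
    ext
    · simp only [wittMul, add_pow_char]
      ring
    · simp only [wittMul, add_pow_char, mul_pow, wittC_pow_char hp]
      linear_combination lam ^ p * hcocycle + nu ^ p * wittC p u.1 v.1 * hlam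
  · simp only [wittPhi_eq hp hodd, wittC, ← pow_mul]
end

section
/- (Example 2: the action of ℤ/p² extends to the model.) Let p be an odd prime, S a commutative ring of characteristic p, π, w ∈ S, and n₁ ≥ 1 an integer; set m̃₁ = n₁(p(p−1)+1). Suppose (Z₁,Z₂) ∈ S × S satisfies Z₁^p − π^{(p−1)p n₁} Z₁ = w and Z₂^p − π^{(p−1) m̃₁} Z₂ = π^{p m̃₁} w − Σ_{k=1}^{p−1} (1/p)·binom(p,k)·π^{p n₁ (p−1)(p−1−k)}·Z₁^{pk}·(−Z₁)^{p−k}. Then for any u₁, u₂ ∈ S with u₁^p = u₁ and u₂^p = u₂, the pair (Z₁ + π^{p n₁} u₁, Z₂ + π^{m̃₁} u₂ + Σ_{k=1}^{p−1} (1/p)·binom(p,k)·π^{n₁(p(p−1)+1−pk)}·Z₁^k·u₁^{p−k}) satisfies the same two equations. -/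
/-- The polynomial `((X + b * y) ^ p - X ^ p - (b * y) ^ p) / (p * b)`: the Witt addition polynomial
at `X` and `b * y`, with one factor `b` divided out. -/
def dividedWittSum {R : Type*} [CommRing R] (p : ℕ) (b X y : R) : R :=
  ∑ k ∈ Finset.Ico 1 p, ((p.choose k / p : ℕ) : R) * b ^ (p - 1 - k) * X ^ k * y ^ (p - k)

theorem prime_mul_mul_dividedWittSum {R : Type*} [CommRing R] {p : ℕ} (hp : p.Prime)
    (b X y : R) :
    (p : R) * b * dividedWittSum p b X y = (X + b * y) ^ p - X ^ p - (b * y) ^ p := by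
  rw [add_pow, Finset.sum_range_succ, Finset.range_eq_Ico,
    Finset.sum_eq_sum_Ico_succ_bot hp.pos, dividedWittSum, Finset.mul_sum]
  have hsum : ∑ k ∈ Finset.Ico 1 p, (p : R) * b *
      (((p.choose k / p : ℕ) : R) * b ^ (p - 1 - k) * X ^ k * y ^ (p - k)) =
      ∑ k ∈ Finset.Ico (0 + 1) p, X ^ k * (b * y) ^ (p - k) * (p.choose k : R) := by
    refine Finset.sum_congr (by simp) fun k hk => ?_
    obtain ⟨hk1, hkp⟩ := Finset.mem_Ico.mp hk
    have hc : (p.choose k : R) = ((p.choose k / p : ℕ) : R) * (p : R) := by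
      rw [← Nat.cast_mul, Nat.div_mul_cancel (hp.dvd_choose_self (by omega) hkp)]
    rw [hc, mul_pow, show p - k = p - 1 - k + 1 by omega, pow_succ b]
    ring
  rw [hsum]
  simp

theorem map_dividedWittSum {R R' : Type*} [CommRing R] [CommRing R'] (f : R →+* R') (p : ℕ)
    (b X y : R) : f (dividedWittSum p b X y) = dividedWittSum p (f b) (f X) (f y) := by
  simp [dividedWittSum]

/-- The cocycle identity of the Witt addition polynomial, with the factor `b` divided out. -/
theorem dividedWittSum_cocycle {R : Type*} [CommRing R] {p : ℕ} (hp : p.Prime) (hodd : Odd p)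
    (b X z v : R) :
    dividedWittSum p b X v - b ^ (p - 1) * dividedWittSum p 1 z v =
      dividedWittSum p b X (-z) - dividedWittSum p b (X + b * v) (-(z + v)) := by
  have generic : ∀ B Y Z V : MvPolynomial (Fin 4) ℤ, B ≠ 0 →
      dividedWittSum p B Y V - B ^ (p - 1) * dividedWittSum p 1 Z V =
        dividedWittSum p B Y (-Z) - dividedWittSum p B (Y + B * V) (-(Z + V)) := by
    intro B Y Z V hB
    have hpB : (p : MvPolynomial (Fin 4) ℤ) * B ≠ 0 :=
      mul_ne_zero (Nat.cast_ne_zero.mpr hp.ne_zero) hB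
    apply mul_left_cancel₀ hpB
    have hz : (p : MvPolynomial (Fin 4) ℤ) * B * (B ^ (p - 1) * dividedWittSum p 1 Z V) =
        (B * (Z + V)) ^ p - (B * Z) ^ p - (B * V) ^ p := by
      have h := prime_mul_mul_dividedWittSum hp 1 Z V
      rw [mul_one, one_mul] at h
      calc _ = B ^ (p - 1) * B * ((p : MvPolynomial (Fin 4) ℤ) * dividedWittSum p 1 Z V) := by ring
        _ = _ := by rw [h, pow_sub_one_mul hp.ne_zero]; simp only [mul_pow]; ring
    rw [mul_sub, mul_sub, hz, prime_mul_mul_dividedWittSum hp, prime_mul_mul_dividedWittSum hp,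
      prime_mul_mul_dividedWittSum hp, mul_neg, mul_neg, hodd.neg_pow, hodd.neg_pow,
      show Y + B * V + -(B * (Z + V)) = Y + -(B * Z) by ring]
    ring
  have h := congrArg (MvPolynomial.eval₂Hom (Int.castRingHom R) ![b, X, z, v])
    (generic (MvPolynomial.X 0) (MvPolynomial.X 1) (MvPolynomial.X 2) (MvPolynomial.X 3)
      (MvPolynomial.X_ne_zero 0))
  simpa [map_sub, map_mul, map_pow, map_dividedWittSum] using h


/-- Example 2:  the action of `ℤ/p²` extends to the model.  Let `p` be an odd prime, `S` a
commutative ring of characteristic `p`, `π, w ∈ S` and `n₁ ≥ 1`; set `m̃₁ = n₁(p(p−1)+1)`.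
If `(Z₁,Z₂)` satisfies `Z₁^p − π^{(p−1)p n₁} Z₁ = w` and
`Z₂^p − π^{(p−1)m̃₁} Z₂ = π^{p m̃₁} w − Σ_{k=1}^{p−1} (1/p)binom(p,k) π^{p n₁(p−1)(p−1−k)} Z₁^{pk} (−Z₁)^{p−k}`,
then for any `u₁, u₂ ∈ S` with `u₁^p = u₁` and `u₂^p = u₂`, the pair
`(Z₁ + π^{p n₁} u₁, Z₂ + π^{m̃₁} u₂ + Σ_{k=1}^{p−1} (1/p)binom(p,k) π^{n₁(p(p−1)+1−pk)} Z₁^k u₁^{p−k})`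
satisfies the same two equations. -/
theorem zmod_p_sq_action_extends (p : ℕ) (hp : p.Prime) (hodd : Odd p)
    (S : Type*) [CommRing S] [CharP S p] (pi w : S)
    (n₁ : ℕ) (hn₁ : 1 ≤ n₁) (m : ℕ) (hm : m = n₁ * (p * (p - 1) + 1))
    (Z₁ Z₂ : S)
    (h1 : Z₁ ^ p - pi ^ ((p - 1) * p * n₁) * Z₁ = w)
    (h2 : Z₂ ^ p - pi ^ ((p - 1) * m) * Z₂
      = pi ^ (p * m) * w - ∑ k ∈ Finset.Ico 1 p,
          ((p.choose k / p : ℕ) : S) * pi ^ (p * n₁ * (p - 1) * (p - 1 - k))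
            * Z₁ ^ (p * k) * (-Z₁) ^ (p - k))
    (u₁ u₂ : S) (hu₁ : u₁ ^ p = u₁) (hu₂ : u₂ ^ p = u₂)
    (Z₁' Z₂' : S)
    (hZ₁' : Z₁' = Z₁ + pi ^ (p * n₁) * u₁)
    (hZ₂' : Z₂' = Z₂ + pi ^ m * u₂ + ∑ k ∈ Finset.Ico 1 p,
        ((p.choose k / p : ℕ) : S) * pi ^ (n₁ * (p * (p - 1) + 1 - p * k))
          * Z₁ ^ k * u₁ ^ (p - k)) :
    Z₁' ^ p - pi ^ ((p - 1) * p * n₁) * Z₁' = w ∧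
    Z₂' ^ p - pi ^ ((p - 1) * m) * Z₂'
      = pi ^ (p * m) * w - ∑ k ∈ Finset.Ico 1 p,
          ((p.choose k / p : ℕ) : S) * pi ^ (p * n₁ * (p - 1) * (p - 1 - k))
            * Z₁' ^ (p * k) * (-Z₁') ^ (p - k) := by
 
  have : Fact p.Prime := ⟨hp⟩
  have : ExpChar S p := ExpChar.prime hp
  subst hm hZ₁' hZ₂'
  obtain ⟨q, rfl⟩ : ∃ q, p = q + 1 := ⟨p - 1, by have := hp.pos; omega⟩
  simp only [Nat.add_sub_cancel] at *
  set b := pi ^ (q * (q + 1) * n₁) with hb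
  set v := pi ^ ((q + 1) * n₁) * u₁ with hv
  have hvp : v ^ (q + 1) = b * v := by
    rw [hv, mul_pow, hu₁, hb]
    ring
  have hZp : (Z₁ + v) ^ (q + 1) = Z₁ ^ (q + 1) + b * v := by
    rw [add_pow_char, hvp]
  have hT : ∀ Z : S, ∑ k ∈ Finset.Ico 1 (q + 1),
      (((q + 1).choose k / (q + 1) : ℕ) : S) * pi ^ ((q + 1) * n₁ * q * (q - k))
        * Z ^ ((q + 1) * k) * (-Z) ^ (q + 1 - k) =
      dividedWittSum (q + 1) b (Z ^ (q + 1)) (-Z) := by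
    intro Z
    refine Finset.sum_congr rfl fun k _ => ?_
    rw [Nat.add_sub_cancel, hb, ← pow_mul, ← pow_mul,
      show (q + 1) * n₁ * q * (q - k) = q * (q + 1) * n₁ * (q - k) by ring]
  rw [hT] at h2 ⊢
  set P := ∑ k ∈ Finset.Ico 1 (q + 1), (((q + 1).choose k / (q + 1) : ℕ) : S) *
    pi ^ (n₁ * ((q + 1) * q + 1 - (q + 1) * k)) * Z₁ ^ k * u₁ ^ (q + 1 - k) with hP
  have hPp : P ^ (q + 1) = dividedWittSum (q + 1) b (Z₁ ^ (q + 1)) v := by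
    rw [hP, sum_pow_char]
    refine Finset.sum_congr rfl fun k hk => ?_
    obtain ⟨j, rfl⟩ : ∃ j, q = k + j := ⟨q - k, by have := Finset.mem_Ico.mp hk; omega⟩
    have hc : (((k + j + 1).choose k / (k + j + 1) : ℕ) : S) ^ (k + j + 1) =
        (((k + j + 1).choose k / (k + j + 1) : ℕ) : S) := by
      rw [← frobenius_def, map_natCast]
    rw [mul_pow, mul_pow, mul_pow, hc, pow_right_comm u₁, hu₁, hb, hv,
      show k + j + 1 - 1 - k = j by omega, show k + j + 1 - k = j + 1 by omega,
      show (k + j + 1) * (k + j) + 1 - (k + j + 1) * k = (k + j + 1) * j + 1 by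
        rw [mul_add]; omega]
    ring
  have hPb : pi ^ (q * (n₁ * ((q + 1) * q + 1))) * P = b ^ q * dividedWittSum (q + 1) 1 Z₁ v := by
    rw [hP, dividedWittSum, Finset.mul_sum, Finset.mul_sum]
    refine Finset.sum_congr rfl fun k hk => ?_
    obtain ⟨j, rfl⟩ : ∃ j, q = k + j := ⟨q - k, by have := Finset.mem_Ico.mp hk; omega⟩
    rw [hb, hv, one_pow, show k + j + 1 - k = j + 1 by omega,
      show (k + j + 1) * (k + j) + 1 - (k + j + 1) * k = (k + j + 1) * j + 1 by
        rw [mul_add]; omega]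
    ring
  have hu : (pi ^ (n₁ * ((q + 1) * q + 1)) * u₂) ^ (q + 1) =
      pi ^ (q * (n₁ * ((q + 1) * q + 1))) * (pi ^ (n₁ * ((q + 1) * q + 1)) * u₂) := by
    rw [mul_pow, hu₂]
    ring
  have hcocycle := dividedWittSum_cocycle hp hodd b (Z₁ ^ (q + 1)) Z₁ v
  rw [Nat.add_sub_cancel] at hcocycle
  refine ⟨?_, ?_⟩
  · rw [hZp, ← h1]
    ring
  · rw [add_pow_char, add_pow_char, hu, hPp, hZp]
    linear_combination h2 + hcocycle - hPb
end

section
/- (Example 2: the action of the effective model 𝒢 = 𝒦_{λ,ν} preserves the equations.) Let p be an odd prime, S a commutative ring of characteristic p, π, w ∈ S, and n₁ ≥ 1 an integer; set m̃₁ = n₁(p(p−1)+1). Suppose (Z₁,Z₂) ∈ S × S satisfies Z₁^p − π^{(p−1)p n₁} Z₁ = w and Z₂^p − π^{(p−1) m̃₁} Z₂ = π^{p m̃₁} w − Σ_{k=1}^{p−1} (1/p)·binom(p,k)·π^{p n₁ (p−1)(p−1−k)}·Z₁^{pk}·(−Z₁)^{p−k}. Then for any v₁, v₂ ∈ S with v₁^p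 = π^{n₁(p−1)} v₁ and v₂^p = π^{n₁(p−1)(p²−p+1)} v₂, the pair (Z₁ + π^{(p−1) n₁} v₁, Z₂ + v₂ + Σ_{k=1}^{p−1} (1/p)·binom(p,k)·π^{n₁(p−1)(p−1−k)}·Z₁^k·v₁^{p−k}) satisfies the same two equations. -/
open Finset

/-- The polynomial `((X + t * Y) ^ p - X ^ p - (t * Y) ^ p) / (p * t)`, with its denominators
cancelled. -/
def twistedCocycle {R : Type*} [CommRing R] (p : ℕ) (t X Y : R) : R :=
  ∑ k ∈ Ico 1 p, ((p.choose k / p : ℕ) : R) * t ^ (p - 1 - k) * X ^ k * Y ^ (p - k)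

section

variable {R : Type*} [CommRing R] {p : ℕ}

theorem map_twistedCocycle {R' : Type*} [CommRing R'] (f : R →+* R') (t X Y : R) :
    f (twistedCocycle p t X Y) = twistedCocycle p (f t) (f X) (f Y) := by
  simp [twistedCocycle, map_sum]

theorem twistedCocycle_mul_left (s t X Y : R) :
    twistedCocycle p (s * t) (s * X) Y = s ^ (p - 1) * twistedCocycle p t X Y := by
  simp only [twistedCocycle, mul_sum]
  refine sum_congr rfl fun k hk => ?_
  obtain ⟨-, hk⟩ := mem_Ico.mp hk
  obtain ⟨d, rfl⟩ := Nat.exists_eq_add_of_lt hk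
  rw [show k + d + 1 - 1 - k = d by omega, show k + d + 1 - 1 = k + d by omega]
  ring

theorem mul_twistedCocycle (t X Y : R) :
    t * twistedCocycle p t X Y = twistedCocycle p 1 X (t * Y) := by
  simp only [twistedCocycle, mul_sum]
  refine sum_congr rfl fun k hk => ?_
  obtain ⟨-, hk⟩ := mem_Ico.mp hk
  obtain ⟨d, rfl⟩ := Nat.exists_eq_add_of_lt hk
  rw [show k + d + 1 - 1 - k = d by omega, show k + d + 1 - k = d + 1 by omega]
  ring

theorem natCast_mul_twistedCocycle_one (hp : p.Prime) (X Y : R) :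
    p * twistedCocycle p 1 X Y = (X + Y) ^ p - X ^ p - Y ^ p := by
  have h : (X + Y) ^ p = Y ^ p + ∑ k ∈ Ico 1 p, X ^ k * Y ^ (p - k) * p.choose k + X ^ p := by
    rw [add_pow, sum_range_succ, range_eq_Ico, sum_eq_sum_Ico_succ_bot hp.pos]
    simp
  rw [h, twistedCocycle, mul_sum]
  have h' : ∀ k ∈ Ico 1 p, (p : R) * (((p.choose k / p : ℕ) : R) * 1 ^ (p - 1 - k) * X ^ k *
      Y ^ (p - k)) = X ^ k * Y ^ (p - k) * p.choose k := by
    intro k hk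
    obtain ⟨hk₁, hk₂⟩ := mem_Ico.mp hk
    have hc : (p : R) * ((p.choose k / p : ℕ) : R) = p.choose k := by
      rw [← Nat.cast_mul, Nat.mul_div_cancel' (hp.dvd_choose_self (by omega) hk₂)]
    rw [← hc, one_pow]
    ring
  rw [sum_congr rfl h']
  ring

theorem natCast_mul_mul_twistedCocycle (hp : p.Prime) (t X Y : R) :
    p * t * twistedCocycle p t X Y = (X + t * Y) ^ p - X ^ p - (t * Y) ^ p := by
  rw [mul_assoc, mul_twistedCocycle, natCast_mul_twistedCocycle_one hp]

theorem twistedCocycle_add_of_isDomain [IsDomain R] [CharZero R] (hp : p.Prime) (hodd : Odd p)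
    {t : R} (ht : t ≠ 0) (X Z Y : R) :
    twistedCocycle p t (X + t * Y) (-(Z + Y)) = twistedCocycle p t X (-Z)
      + t ^ (p - 1) * twistedCocycle p 1 Z Y - twistedCocycle p t X Y := by
  have hpt : (p : R) * t ≠ 0 := mul_ne_zero (Nat.cast_ne_zero.mpr hp.ne_zero) ht
  have h := natCast_mul_mul_twistedCocycle hp t (t * Z) Y
  have h' := twistedCocycle_mul_left (p := p) t 1 Z Y
  rw [mul_one] at h'
  rw [← h']
  refine mul_left_cancel₀ hpt ?_
  rw [mul_sub, mul_add, h]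
  simp only [natCast_mul_mul_twistedCocycle hp, mul_neg, hodd.neg_pow]
  rw [show X + t * Y + -(t * (Z + Y)) = X + -(t * Z) by ring, mul_add]
  ring

/-- The cocycle relation of `twistedCocycle`, with a factor `t` cancelled. -/
theorem twistedCocycle_add (hp : p.Prime) (hodd : Odd p) (t X Z Y : R) :
    twistedCocycle p t (X + t * Y) (-(Z + Y)) = twistedCocycle p t X (-Z)
      + t ^ (p - 1) * twistedCocycle p 1 Z Y - twistedCocycle p t X Y := by
  have h := congrArg (MvPolynomial.eval₂Hom (Int.castRingHom R) ![t, X, Z, Y])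
    (twistedCocycle_add_of_isDomain hp hodd (MvPolynomial.X_ne_zero (R := ℤ) (0 : Fin 4))
      (.X 1) (.X 2) (.X 3))
  simp only [map_add, map_sub, map_mul, map_neg, map_pow, map_one, map_twistedCocycle] at h
  simpa using h

theorem twistedCocycle_pow_char [CharP R p] (hp : p.Prime) (t X Y : R) :
    twistedCocycle p t X Y ^ p = twistedCocycle p (t ^ p) (X ^ p) (Y ^ p) := by
  have := Fact.mk hp
  simpa only [frobenius_def] using map_twistedCocycle (frobenius R p) t X Y

end

/-- Example 2:  the action of the effective model `𝒢 = 𝒦_{λ,ν}` (with `λ = π^{n₁(p−1)²}` and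
`ν = π^{n₁(p−1)}`) preserves the equations of the model.  Let `p` be an odd prime, `S` a
commutative ring of characteristic `p`, `π, w ∈ S` and `n₁ ≥ 1`; set `m̃₁ = n₁(p(p−1)+1)`.
If `(Z₁,Z₂)` satisfies `Z₁^p − π^{(p−1)p n₁} Z₁ = w` and
`Z₂^p − π^{(p−1)m̃₁} Z₂ = π^{p m̃₁} w − Σ_{k=1}^{p−1} (1/p)binom(p,k) π^{p n₁(p−1)(p−1−k)} Z₁^{pk} (−Z₁)^{p−k}`,
then for any `v₁, v₂ ∈ S` with `v₁^p = π^{n₁(p−1)} v₁` and `v₂^p = π^{n₁(p−1)(p²−p+1)} v₂`,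
the pair
`(Z₁ + π^{(p−1)n₁} v₁, Z₂ + v₂ + Σ_{k=1}^{p−1} (1/p)binom(p,k) π^{n₁(p−1)(p−1−k)} Z₁^k v₁^{p−k})`
satisfies the same two equations. -/
theorem effective_model_action_extends (p : ℕ) (hp : p.Prime) (hodd : Odd p)
    (S : Type*) [CommRing S] [CharP S p] (pi w : S)
    (n₁ : ℕ) (hn₁ : 1 ≤ n₁) (m : ℕ) (hm : m = n₁ * (p * (p - 1) + 1))
    (Z₁ Z₂ : S)
    (h1 : Z₁ ^ p - pi ^ ((p - 1) * p * n₁) * Z₁ = w)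
    (h2 : Z₂ ^ p - pi ^ ((p - 1) * m) * Z₂
      = pi ^ (p * m) * w - ∑ k ∈ Finset.Ico 1 p,
          ((p.choose k / p : ℕ) : S) * pi ^ (p * n₁ * (p - 1) * (p - 1 - k))
            * Z₁ ^ (p * k) * (-Z₁) ^ (p - k))
    (v₁ v₂ : S)
    (hv₁ : v₁ ^ p = pi ^ (n₁ * (p - 1)) * v₁)
    (hv₂ : v₂ ^ p = pi ^ (n₁ * (p - 1) * (p * p - p + 1)) * v₂)
    (Z₁' Z₂' : S)
    (hZ₁' : Z₁' = Z₁ + pi ^ ((p - 1) * n₁) * v₁)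
    (hZ₂' : Z₂' = Z₂ + v₂ + ∑ k ∈ Finset.Ico 1 p,
        ((p.choose k / p : ℕ) : S) * pi ^ (n₁ * (p - 1) * (p - 1 - k))
          * Z₁ ^ k * v₁ ^ (p - k)) :
    Z₁' ^ p - pi ^ ((p - 1) * p * n₁) * Z₁' = w ∧
    Z₂' ^ p - pi ^ ((p - 1) * m) * Z₂'
      = pi ^ (p * m) * w - ∑ k ∈ Finset.Ico 1 p,
          ((p.choose k / p : ℕ) : S) * pi ^ (p * n₁ * (p - 1) * (p - 1 - k))
            * Z₁' ^ (p * k) * (-Z₁') ^ (p - k) := by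
  have := Fact.mk hp
  set b := pi ^ ((p - 1) * n₁) with hb
  have hbp : pi ^ ((p - 1) * p * n₁) = b ^ p := by rw [hb, ← pow_mul]; congr 1; ring
  have hsum : ∀ Z : S, ∑ k ∈ Finset.Ico 1 p,
      ((p.choose k / p : ℕ) : S) * pi ^ (p * n₁ * (p - 1) * (p - 1 - k))
        * Z ^ (p * k) * (-Z) ^ (p - k) = twistedCocycle p (b ^ p) (Z ^ p) (-Z) := by
    intro Z
    refine Finset.sum_congr rfl fun k _ => ?_
    rw [hb, ← pow_mul, ← pow_mul, ← pow_mul]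
    congr 4
    ring
  have hsum' : ∑ k ∈ Finset.Ico 1 p,
      ((p.choose k / p : ℕ) : S) * pi ^ (n₁ * (p - 1) * (p - 1 - k))
        * Z₁ ^ k * v₁ ^ (p - k) = twistedCocycle p b Z₁ v₁ := by
    refine Finset.sum_congr rfl fun k _ => ?_
    rw [hb, ← pow_mul]
    congr 4
    ring
  have hbm : pi ^ ((p - 1) * m) = (b ^ p) ^ (p - 1) * b := by
    rw [hb, ← pow_mul, ← pow_mul, ← pow_add, hm]
    congr 1
    ring
  have hv₂' : v₂ ^ p = pi ^ ((p - 1) * m) * v₂ := by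
    rw [hv₂, hm, Nat.mul_sub p p 1, mul_one]
    congr 2
    ring
  rw [show n₁ * (p - 1) = (p - 1) * n₁ by ring, ← hb] at hv₁
  have hZp : Z₁' ^ p = Z₁ ^ p + b ^ p * (b * v₁) := by
    rw [hZ₁', add_pow_char, mul_pow, hv₁]
  rw [hbp] at h1 ⊢
  rw [hsum, hbm] at h2 ⊢
  rw [hbm] at hv₂'
  rw [hsum'] at hZ₂'
  refine ⟨by rw [hZp, hZ₁', ← h1]; ring, ?_⟩
  have hc := twistedCocycle_add hp hodd (b ^ p) (Z₁ ^ p) Z₁ (b * v₁)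
  rw [← mul_twistedCocycle] at hc
  rw [hZp, hZ₁', hc, hZ₂', add_pow_char, add_pow_char, twistedCocycle_pow_char hp, hv₁, hv₂']
  linear_combination h2
end

section
/- (Example 2: failure of the torsor property on the special fibre.) Let p be a prime and S a commutative ring of characteristic p. Let N = {(v₁,v₂) ∈ S × S : v₁^p = 0 and v₂^p = 0}; this is a subgroup of (S × S, +) under componentwise addition. The formula (v₁,v₂)·(z₁,z₂) = (z₁, z₂ + v₂ + v₁ z₁^{p−1}) defines an action of the group N on the set S × S, and for every (z₁,z₂) ∈ S × S the stabilizer of (z₁,z₂) in N is exactly the subgroup {(v₁, −v₁ z₁^{p−1}) : v₁ ∈ S, v₁^p = 0}, which is mapped isomorphically by the first projection onto the additive group {v ∈ S : v^p = 0}. -/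
theorem neg_pow_eq_zero_of_pow_eq_zero {R : Type*} [Ring R] {a : R} {n : ℕ} (h : a ^ n = 0) :
    (-a) ^ n = 0 := by
  rw [neg_pow, h, mul_zero]

theorem prodMk_add_add_eq_self_iff {S : Type*} [Ring S] (z : S × S) (a b : S) :
    (z.1, z.2 + b + a) = z ↔ b = -a := by
  rw [Prod.ext_iff, add_assoc, add_eq_left, eq_neg_iff_add_eq_zero]
  exact and_iff_right rfl

/-- Example 2:  failure of the torsor property on the special fibre.  Let `p` be a prime and `S`
a commutative ring of characteristic `p`.  The set `N = {(v₁,v₂) : v₁^p = 0 ∧ v₂^p = 0}` is a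
subgroup of `(S × S, +)`; the formula `(v₁,v₂)·(z₁,z₂) = (z₁, z₂ + v₂ + v₁ z₁^{p−1})` defines an
action of `N` on `S × S`; the stabilizer of `(z₁,z₂)` in `N` is exactly
`{(v₁, −v₁ z₁^{p−1}) : v₁^p = 0}`, and the first projection maps it bijectively (hence, being
additive, isomorphically) onto the additive group `{v ∈ S : v^p = 0}`. -/
theorem special_fibre_stabilizers (p : ℕ) (hp : p.Prime)
    (S : Type*) [CommRing S] [CharP S p] :
    -- `N` is a subgroup of `S × S` under componentwise addition
    (((0 : S), (0 : S)) ∈ {v : S × S | v.1 ^ p = 0 ∧ v.2 ^ p = 0}) ∧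
    (∀ v w : S × S, v ∈ {v : S × S | v.1 ^ p = 0 ∧ v.2 ^ p = 0} →
      w ∈ {v : S × S | v.1 ^ p = 0 ∧ v.2 ^ p = 0} →
      v + w ∈ {v : S × S | v.1 ^ p = 0 ∧ v.2 ^ p = 0}) ∧
    (∀ v : S × S, v ∈ {v : S × S | v.1 ^ p = 0 ∧ v.2 ^ p = 0} →
      -v ∈ {v : S × S | v.1 ^ p = 0 ∧ v.2 ^ p = 0}) ∧
    -- the formula defines an action of `N` on `S × S`
    (∀ z : S × S, (z.1, z.2 + (0 : S) + (0 : S) * z.1 ^ (p - 1)) = z) ∧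
    (∀ v w z : S × S,
      (let z' : S × S := (z.1, z.2 + w.2 + w.1 * z.1 ^ (p - 1));
        (z'.1, z'.2 + v.2 + v.1 * z'.1 ^ (p - 1)))
      = (z.1, z.2 + (v + w).2 + (v + w).1 * z.1 ^ (p - 1))) ∧
    -- the stabilizer of `z` in `N` is `{(v₁, −v₁ z₁^{p−1}) : v₁^p = 0}`
    (∀ z : S × S,
      {v : S × S | (v.1 ^ p = 0 ∧ v.2 ^ p = 0) ∧ (z.1, z.2 + v.2 + v.1 * z.1 ^ (p - 1)) = z}
        = {v : S × S | ∃ v₁ : S, v₁ ^ p = 0 ∧ v = (v₁, -v₁ * z.1 ^ (p - 1))}) ∧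
    -- the first projection maps the stabilizer bijectively onto `{v : v^p = 0}`
    (∀ z : S × S,
      Set.BijOn Prod.fst
        {v : S × S | (v.1 ^ p = 0 ∧ v.2 ^ p = 0) ∧ (z.1, z.2 + v.2 + v.1 * z.1 ^ (p - 1)) = z}
        {v : S | v ^ p = 0}) := by
  have : Fact p.Prime := ⟨hp⟩
  have stabilizer_eq (z : S × S) :
      {v : S × S | (v.1 ^ p = 0 ∧ v.2 ^ p = 0) ∧ (z.1, z.2 + v.2 + v.1 * z.1 ^ (p - 1)) = z}
        = {v : S × S | ∃ v₁ : S, v₁ ^ p = 0 ∧ v = (v₁, -v₁ * z.1 ^ (p - 1))} := by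
    ext ⟨a, b⟩
    simp only [Set.mem_ofPred_eq, prodMk_add_add_eq_self_iff, ← neg_mul]
    constructor
    · rintro ⟨⟨ha, -⟩, rfl⟩
      exact ⟨a, ha, rfl⟩
    · rintro ⟨c, hc, h⟩
      obtain ⟨rfl, rfl⟩ := Prod.mk.inj h
      exact ⟨⟨hc, by rw [mul_pow, neg_pow_eq_zero_of_pow_eq_zero hc, zero_mul]⟩, rfl⟩
  refine ⟨⟨zero_pow hp.ne_zero, zero_pow hp.ne_zero⟩, ?_, ?_, fun z ↦ by simp, ?_,
    stabilizer_eq, fun z ↦ ?_⟩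
  · rintro v w ⟨hv₁, hv₂⟩ ⟨hw₁, hw₂⟩
    constructor
    · rw [Prod.fst_add, add_pow_char, hv₁, hw₁, add_zero]
    · rw [Prod.snd_add, add_pow_char, hv₂, hw₂, add_zero]
  · rintro v ⟨hv₁, hv₂⟩
    exact ⟨neg_pow_eq_zero_of_pow_eq_zero hv₁, neg_pow_eq_zero_of_pow_eq_zero hv₂⟩
  · intro v w z
    ext
    · rfl
    · simp only [Prod.fst_add, Prod.snd_add]
      ring
  · rw [stabilizer_eq]
    refine ⟨?_, ?_, fun a ha ↦ ⟨_, ⟨a, ha, rfl⟩, rfl⟩⟩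
    · rintro _ ⟨a, ha, rfl⟩
      exact ha
    · rintro _ ⟨a, -, rfl⟩ _ ⟨b, -, rfl⟩ (rfl : a = b)
      rfl
end
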